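/- arXiv:1006.4445 — 2 statements merged into one kernel-verified Lean document; each statement's English description precedes it below -/
import Mathlib

section
/- There exist two convex triangular prisms in hyperbolic 3-space with the same combinatorics and the same edge lengths that are not congruent. Precisely: there exist injective maps x, x' : {0,…,5} → H³ such that (i) for each face F of the abstract triangular prism (triangles {0,1,2} and {3,4,5}; quadrilaterals {0,1,4,3}, {1,2,5,4}, {2,0,3,5}) and for each of the two configurations, there is a vector w ∈ ℝ⁴ with Minkowski norm ⟨w,w⟩ = 1 satisfying ⟨w, x(i)⟩ = 0 for every i ∈ F and ⟨w, x(j)⟩ < 0 for every j ∉ F (so the vertices of each face lie on a common geodesic plane and all other vertices lie strictly on one side of it, making the configuration a convex polyhedron); (ii) ⟨x(i), x(j)⟩ = ⟨x'(i), x'(j)⟩ for every edge {i,j} of the prism (the six triangle edges together with {0,3}, {1,4}, {2,5}), so corresponding edges have equal hyperbolic lengths arccosh(−⟨x(i),x(j)⟩); and (iii) there is no 4×4 real matrix A with Aᵀ η A = η whose action maps the set {x(0),…,x(5)} onto the set {x'(0),…,x'(5)}. -/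
noncomputable section
open Matrix

/-- Minkowski inner product on ℝ⁴: ⟨x,y⟩ = −x₀y₀ + x₁y₁ + x₂y₂ + x₃y₃. -/
def mink (x y : Fin 4 → ℝ) : ℝ :=
  -(x 0 * y 0) + x 1 * y 1 + x 2 * y 2 + x 3 * y 3

/-- The hyperboloid model of hyperbolic 3-space. -/
def Hyp : Set (Fin 4 → ℝ) := {x | 0 < x 0 ∧ mink x x = -1}

/-- The matrix η = diag(−1,1,1,1) of the Minkowski inner product. -/
def eta : Matrix (Fin 4) (Fin 4) ℝ := Matrix.diagonal ![(-1 : ℝ), 1, 1, 1]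

/-- The faces of the abstract triangular prism on vertices {0,…,5}: the two
triangles and the three quadrilaterals. -/
def prismFaces : List (Finset (Fin 6)) :=
  [{0, 1, 2}, {3, 4, 5}, {0, 1, 4, 3}, {1, 2, 5, 4}, {2, 0, 3, 5}]

/-- The edges of the abstract triangular prism: the six triangle edges together
with the three vertical edges. -/
def prismEdges : List (Fin 6 × Fin 6) :=
  [(0, 1), (1, 2), (2, 0), (3, 4), (4, 5), (5, 3), (0, 3), (1, 4), (2, 5)]

/-- `x : Fin 6 → ℝ⁴` realizes the abstract triangular prism as a convex
polyhedron in H³: the map is injective, the vertices lie on H³, and for each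
face there is a spacelike unit vector `w` whose orthogonal geodesic plane
contains the vertices of the face, with all other vertices strictly on one
side. -/
def IsConvexHypPrism (x : Fin 6 → (Fin 4 → ℝ)) : Prop :=
  Function.Injective x ∧ (∀ i, x i ∈ Hyp) ∧
    ∀ F ∈ prismFaces, ∃ w : Fin 4 → ℝ, mink w w = 1 ∧
      (∀ i ∈ F, mink w (x i) = 0) ∧ (∀ j, j ∉ F → mink w (x j) < 0)

theorem v2 (a b c d : ℝ) : (![a, b, c, d] : Fin 4 → ℝ) 2 = c := rfl

theorem v3 (a b c d : ℝ) : (![a, b, c, d] : Fin 4 → ℝ) 3 = d := rfl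

theorem unit_of_pos (x : Fin 6 → (Fin 4 → ℝ)) (F : Finset (Fin 6))
    (h : ∃ w : Fin 4 → ℝ, 0 < mink w w ∧
      (∀ i ∈ F, mink w (x i) = 0) ∧ (∀ j, j ∉ F → mink w (x j) < 0)) :
    ∃ w : Fin 4 → ℝ, mink w w = 1 ∧
      (∀ i ∈ F, mink w (x i) = 0) ∧ (∀ j, j ∉ F → mink w (x j) < 0) := by
  obtain ⟨w, hw, h1, h2⟩ := h
  have hs : 0 < Real.sqrt (mink w w) := Real.sqrt_pos.2 hw
  have hq : Real.sqrt (mink w w) ^ 2 = mink w w := Real.sq_sqrt hw.le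
  generalize Real.sqrt (mink w w) = s at hs hq
  have hl : ∀ y, mink (s⁻¹ • w) y = s⁻¹ * mink w y := by
    intro y; simp only [mink, Pi.smul_apply, smul_eq_mul]; ring
  have hr : ∀ y, mink y (s⁻¹ • w) = s⁻¹ * mink y w := by
    intro y; simp only [mink, Pi.smul_apply, smul_eq_mul]; ring
  refine ⟨s⁻¹ • w, ?_, ?_, ?_⟩
  · rw [hl, hr, ← hq]; field_simp
  · intro i hi; rw [hl, h1 i hi, mul_zero]
  · intro j hj; rw [hl]; exact mul_neg_of_pos_of_neg (inv_pos.2 hs) (h2 j hj)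

theorem mink_eq (x y : Fin 4 → ℝ) : mink x y = x ⬝ᵥ (eta *ᵥ y) := by
  simp [mink, eta, dotProduct, Matrix.mulVec_diagonal, Fin.sum_univ_four]

theorem mink_mulVec (A : Matrix (Fin 4) (Fin 4) ℝ) (hA : Aᵀ * eta * A = eta)
    (x y : Fin 4 → ℝ) : mink (A *ᵥ x) (A *ᵥ y) = mink x y := by
  rw [mink_eq, mink_eq]
  conv_rhs => rw [← hA]
  rw [← Matrix.mulVec_mulVec, ← Matrix.mulVec_mulVec, Matrix.dotProduct_mulVec x Aᵀ,
    Matrix.vecMul_transpose]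

def xA : Fin 6 → (Fin 4 → ℝ) :=
  ![![3, 2, 0, 2],
    ![3, -2, 0, 2],
    ![9/8, 0, 1/2, 1/8],
    ![201/88, 8/11, 0, 169/88],
    ![201/88, -8/11, 0, 169/88],
    ![249/208, 0, 4/13, 121/208]]

theorem xA_0 : xA 0 = ![3, 2, 0, 2] := rfl

theorem xA_1 : xA 1 = ![3, -2, 0, 2] := rfl

theorem xA_2 : xA 2 = ![9/8, 0, 1/2, 1/8] := rfl

theorem xA_3 : xA 3 = ![201/88, 8/11, 0, 169/88] := rfl

theorem xA_4 : xA 4 = ![201/88, -8/11, 0, 169/88] := rfl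

theorem xA_5 : xA 5 = ![249/208, 0, 4/13, 121/208] := rfl

theorem xA_prism : IsConvexHypPrism xA := by
  refine ⟨?_, ?_, ?_⟩
  · intro i j h
    have h0 := congrFun h 0
    have h1 := congrFun h 1
    have h2 := congrFun h 2
    fin_cases i <;> fin_cases j <;> first | rfl | (exfalso; revert h0 h1 h2; norm_num [v2, v3, xA])
  · intro i
    fin_cases i <;> norm_num [Hyp, mink, v2, v3, xA]
  · intro F hF
    apply unit_of_pos
    simp only [prismFaces, List.mem_cons, List.not_mem_nil, or_false] at hF
    rcases hF with rfl | rfl | rfl | rfl | rfl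
    · refine ⟨![-2, 0, -15/4, -3], by norm_num [mink, v2, v3], ?_, ?_⟩ <;> intro i hi <;>
        fin_cases i <;> first | (exact absurd hi (by decide)) | norm_num [mink, v2, v3, xA]
    · refine ⟨![169/32, 0, 555/64, 201/32], by norm_num [mink, v2, v3], ?_, ?_⟩ <;> intro i hi <;>
        fin_cases i <;> first | (exact absurd hi (by decide)) | norm_num [mink, v2, v3, xA]
    · refine ⟨![0, 0, -4, 0], by norm_num [mink, v2, v3], ?_, ?_⟩ <;> intro i hi <;>
        fin_cases i <;> first | (exact absurd hi (by decide)) | norm_num [mink, v2, v3, xA]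
    · refine ⟨![1, -1/2, 2, 1], by norm_num [mink, v2, v3], ?_, ?_⟩ <;> intro i hi <;>
        fin_cases i <;> first | (exact absurd hi (by decide)) | norm_num [mink, v2, v3, xA]
    · refine ⟨![1, 1/2, 2, 1], by norm_num [mink, v2, v3], ?_, ?_⟩ <;> intro i hi <;>
        fin_cases i <;> first | (exact absurd hi (by decide)) | norm_num [mink, v2, v3, xA]

def xB : Fin 6 → (Fin 4 → ℝ) :=
  ![![3, 2, 0, 2],
    ![3, -2, 0, 2],
    ![21/8, 0, 1/2, 19/8],
    ![201/88, 8/11, 0, 169/88],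
    ![201/88, -8/11, 0, 169/88],
    ![189/52, 0, 4/13, 181/52]]

theorem xB_0 : xB 0 = ![3, 2, 0, 2] := rfl

theorem xB_1 : xB 1 = ![3, -2, 0, 2] := rfl

theorem xB_2 : xB 2 = ![21/8, 0, 1/2, 19/8] := rfl

theorem xB_3 : xB 3 = ![201/88, 8/11, 0, 169/88] := rfl

theorem xB_4 : xB 4 = ![201/88, -8/11, 0, 169/88] := rfl

theorem xB_5 : xB 5 = ![189/52, 0, 4/13, 181/52] := rfl

theorem xB_prism : IsConvexHypPrism xB := by
  refine ⟨?_, ?_, ?_⟩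
  · intro i j h
    have h0 := congrFun h 0
    have h1 := congrFun h 1
    have h2 := congrFun h 2
    fin_cases i <;> fin_cases j <;> first | rfl | (exfalso; revert h0 h1 h2; norm_num [v2, v3, xB])
  · intro i
    fin_cases i <;> norm_num [Hyp, mink, v2, v3, xB]
  · intro F hF
    apply unit_of_pos
    simp only [prismFaces, List.mem_cons, List.not_mem_nil, or_false] at hF
    rcases hF with rfl | rfl | rfl | rfl | rfl
    · refine ⟨![-2, 0, 15/4, -3], by norm_num [mink, v2, v3], ?_, ?_⟩ <;> intro i hi <;>
        fin_cases i <;> first | (exact absurd hi (by decide)) | norm_num [mink, v2, v3, xB]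
    · refine ⟨![169/32, 0, -555/64, 201/32], by norm_num [mink, v2, v3], ?_, ?_⟩ <;> intro i hi <;>
        fin_cases i <;> first | (exact absurd hi (by decide)) | norm_num [mink, v2, v3, xB]
    · refine ⟨![0, 0, -4, 0], by norm_num [mink, v2, v3], ?_, ?_⟩ <;> intro i hi <;>
        fin_cases i <;> first | (exact absurd hi (by decide)) | norm_num [mink, v2, v3, xB]
    · refine ⟨![4, -2, 2, 4], by norm_num [mink, v2, v3], ?_, ?_⟩ <;> intro i hi <;>
        fin_cases i <;> first | (exact absurd hi (by decide)) | norm_num [mink, v2, v3, xB]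
    · refine ⟨![4, 2, 2, 4], by norm_num [mink, v2, v3], ?_, ?_⟩ <;> intro i hi <;>
        fin_cases i <;> first | (exact absurd hi (by decide)) | norm_num [mink, v2, v3, xB]

/-- There exist two convex triangular prisms in H³ with the same combinatorics
and the same edge lengths that are not congruent. -/
theorem noncongruent_prisms_same_edge_lengths :
    ∃ x x' : Fin 6 → (Fin 4 → ℝ),
      IsConvexHypPrism x ∧ IsConvexHypPrism x' ∧
      (∀ e ∈ prismEdges, mink (x e.1) (x e.2) = mink (x' e.1) (x' e.2)) ∧
      ¬ ∃ A : Matrix (Fin 4) (Fin 4) ℝ, Aᵀ * eta * A = eta ∧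
          A.mulVec '' (Set.range x) = Set.range x' := by
  refine ⟨xA, xB, xA_prism, xB_prism, ?_, ?_⟩
  · intro e he
    simp only [prismEdges, List.mem_cons, List.not_mem_nil, or_false] at he
    rcases he with rfl | rfl | rfl | rfl | rfl | rfl | rfl | rfl | rfl <;>
      norm_num [mink, v2, v3, xA_0, xA_1, xA_2, xA_3, xA_4, xA_5,
        xB_0, xB_1, xB_2, xB_3, xB_4, xB_5]
  · rintro ⟨A, hA, hS⟩
    have hm : ∀ k, ∃ i, xB i = A *ᵥ xA k := by
      intro k
      have : A *ᵥ xA k ∈ Set.range xB := hS ▸ ⟨xA k, ⟨k, rfl⟩, rfl⟩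
      exact this
    obtain ⟨i, hi⟩ := hm 0
    obtain ⟨j, hj⟩ := hm 5
    have h := mink_mulVec A hA (xA 0) (xA 5)
    rw [← hi, ← hj, xA_0, xA_5] at h
    clear hi hj
    revert h
    fin_cases i <;> fin_cases j <;> norm_num [mink, v2, v3, xB]
end
end

section
/- (Hyperbolic Fenchel theorem.) Let k ≥ 3 and let p : ℤ/kℤ → H³ be a closed polygonal curve on the hyperboloid with p(j) ≠ p(j+1) for all j, whose vertices are not all contained in a single 2-dimensional linear subspace of ℝ⁴ (i.e. the curve is not contained in a geodesic of H³). For p ≠ q in H³ define the tangent direction u(p,q) = q + ⟨p,q⟩ p, which satisfies ⟨p, u(p,q)⟩ = 0 and ⟨u(p,q), u(p,q)⟩ = ⟨p,q⟩² − 1 > 0, and define the interior angle at vertex p(j) by θ(j) = arccos( ⟨u(p(j),p(j−1)), u(p(j),p(j+1))⟩ / (√⟨u(p(j),p(j−1)),u(p(j),p(j−1))⟩ · √⟨u(p(j),p(j+1)),u(p(j),p(j+1))⟩) ). Then the total turning ∑_{j} (π − θ(j)) is strictly greater than 2π. -/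
noncomputable section

/-- The tangent direction at p pointing towards q: u(p,q) = q + ⟨p,q⟩p. -/
def tangdir (p q : Fin 4 → ℝ) : Fin 4 → ℝ := q + mink p q • p

/-- The interior angle at vertex p₀ of the polygonal path p₋ → p₀ → p₊,
computed by the arccos formula in the tangent space at p₀. -/
def intAngle (pm p0 pp : Fin 4 → ℝ) : ℝ :=
  Real.arccos (mink (tangdir p0 pm) (tangdir p0 pp) /
    (Real.sqrt (mink (tangdir p0 pm) (tangdir p0 pm)) *
      Real.sqrt (mink (tangdir p0 pp) (tangdir p0 pp))))

lemma mink_comm' (x y : Fin 4 → ℝ) : mink x y = mink y x := by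
  unfold mink; ring

lemma mink_tangdir {p : Fin 4 → ℝ} (hp : p ∈ Hyp) (q r : Fin 4 → ℝ) :
    mink (tangdir p q) (tangdir p r) = mink q r + mink p q * mink p r := by
  have h := hp.2
  have : mink (tangdir p q) (tangdir p r) =
      mink q r + 2 * (mink p q * mink p r) + mink p q * mink p r * mink p p := by
    simp only [mink, tangdir, Pi.add_apply, Pi.smul_apply, smul_eq_mul]; ring
  rw [this, h]; ring

lemma mink_tang {p : Fin 4 → ℝ} (hp : p ∈ Hyp) (q : Fin 4 → ℝ) :
    mink p (tangdir p q) = 0 := by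
  have h := hp.2
  have : mink p (tangdir p q) = mink p q + mink p q * mink p p := by
    simp only [mink, tangdir, Pi.add_apply, Pi.smul_apply, smul_eq_mul]; ring
  rw [this, h]; ring

/-- Isometric identification of the tangent space at `p` with Euclidean space. -/
def flat (p u : Fin 4 → ℝ) : EuclideanSpace ℝ (Fin 3) :=
  !₂[u 1 - u 0 / (1 + p 0) * p 1, u 2 - u 0 / (1 + p 0) * p 2, u 3 - u 0 / (1 + p 0) * p 3]

lemma flat_inner {p : Fin 4 → ℝ} (hp : p ∈ Hyp) {u v : Fin 4 → ℝ} (hu : mink p u = 0)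
    (hv : mink p v = 0) : inner ℝ (flat p u) (flat p v) = mink u v := by
  obtain ⟨h0, h1⟩ := hp
  have h2 : 1 + p 0 ≠ 0 := by positivity
  simp only [flat, PiLp.inner_apply, Fin.sum_univ_three]
  simp [mink] at *
  obtain ⟨s, hs⟩ : ∃ s, s * (1 + p 0) = u 0 := ⟨u 0 / (1 + p 0), by field_simp⟩
  obtain ⟨t, ht⟩ : ∃ t, t * (1 + p 0) = v 0 := ⟨v 0 / (1 + p 0), by field_simp⟩
  have hs' : u 0 / (1 + p 0) = s := by rw [← hs]; field_simp
  have ht' : v 0 / (1 + p 0) = t := by rw [← ht]; field_simp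
  rw [hs', ht']
  rw [← hs] at hu ⊢
  rw [← ht] at hv ⊢
  linear_combination (-t) * hu - s * hv + s * t * h1

lemma flat_smul (p u : Fin 4 → ℝ) (c : ℝ) : flat p (c • u) = c • flat p u := by
  ext i
  fin_cases i <;> simp [flat] <;> ring

lemma flat_inj {p : Fin 4 → ℝ} (hp : p ∈ Hyp) {u v : Fin 4 → ℝ} (hu : mink p u = 0)
    (hv : mink p v = 0) (h : flat p u = flat p v) : u = v := by
  obtain ⟨h0, h1⟩ := hp
  have h2 : 1 + p 0 ≠ 0 := by positivity
  have e1 := congrArg (fun x => x 0) h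
  have e2 := congrArg (fun x => x 1) h
  have e3 := congrArg (fun x => x 2) h
  simp [flat] at e1 e2 e3
  simp only [mink] at *
  obtain ⟨s, hs⟩ : ∃ s, s * (1 + p 0) = u 0 := ⟨u 0 / (1 + p 0), by field_simp⟩
  obtain ⟨t, ht⟩ : ∃ t, t * (1 + p 0) = v 0 := ⟨v 0 / (1 + p 0), by field_simp⟩
  have hs' : u 0 / (1 + p 0) = s := by rw [← hs]; field_simp
  have ht' : v 0 / (1 + p 0) = t := by rw [← ht]; field_simp
  rw [hs', ht'] at e1 e2 e3
  rw [← hs] at hu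
  rw [← ht] at hv
  have hst : (s - t) * (1 + p 0) = 0 := by
    linear_combination (-1) * hu + hv + p 1 * e1 + p 2 * e2 + p 3 * e3 + (s - t) * h1
  have hst' : s = t := by
    rcases mul_eq_zero.1 hst with h | h
    · linarith
    · exact absurd h h2
  subst hst'
  ext i
  fin_cases i
  · simp; rw [← hs, ← ht]
  · simp; linarith
  · simp; linarith
  · simp; linarith

lemma intAngle_eq {p : Fin 4 → ℝ} (hp : p ∈ Hyp) (q r : Fin 4 → ℝ) :
    intAngle q p r =
      InnerProductGeometry.angle (flat p (tangdir p q)) (flat p (tangdir p r)) := by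
  unfold intAngle InnerProductGeometry.angle
  rw [norm_eq_sqrt_real_inner, norm_eq_sqrt_real_inner,
    flat_inner hp (mink_tang hp q) (mink_tang hp r),
    flat_inner hp (mink_tang hp q) (mink_tang hp q),
    flat_inner hp (mink_tang hp r) (mink_tang hp r)]

lemma tangdir_self {p : Fin 4 → ℝ} (hp : p ∈ Hyp) : tangdir p p = 0 := by
  unfold tangdir; rw [hp.2]; simp

lemma flat_zero (p : Fin 4 → ℝ) : flat p 0 = 0 := by
  ext i
  fin_cases i <;> simp [flat]

lemma intAngle_self_left {p : Fin 4 → ℝ} (hp : p ∈ Hyp) (r : Fin 4 → ℝ) :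
    intAngle p p r = Real.pi / 2 := by
  rw [intAngle_eq hp, tangdir_self hp, flat_zero, InnerProductGeometry.angle_zero_left]

lemma intAngle_self_right {p : Fin 4 → ℝ} (hp : p ∈ Hyp) (r : Fin 4 → ℝ) :
    intAngle r p p = Real.pi / 2 := by
  rw [intAngle_eq hp, tangdir_self hp, flat_zero, InnerProductGeometry.angle_zero_right]

lemma intAngle_comm {p : Fin 4 → ℝ} (hp : p ∈ Hyp) (q r : Fin 4 → ℝ) :
    intAngle q p r = intAngle r p q := by
  rw [intAngle_eq hp, intAngle_eq hp, InnerProductGeometry.angle_comm]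

lemma intAngle_triangle {p : Fin 4 → ℝ} (hp : p ∈ Hyp) (q r s : Fin 4 → ℝ) :
    intAngle q p s ≤ intAngle q p r + intAngle r p s := by
  rw [intAngle_eq hp, intAngle_eq hp, intAngle_eq hp]
  exact InnerProductGeometry.angle_le_angle_add_angle _ _ _

lemma mink_neg {p q : Fin 4 → ℝ} (hp : p ∈ Hyp) (hq : q ∈ Hyp) : mink p q < 0 := by
  obtain ⟨h0, h1⟩ := hp
  obtain ⟨g0, g1⟩ := hq
  unfold mink at *
  by_contra hcon
  push Not at hcon
  have hpq : 0 < p 0 * q 0 := by positivity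
  have cs : (p 1 * q 1 + p 2 * q 2 + p 3 * q 3) ^ 2 ≤
      (p 1 ^ 2 + p 2 ^ 2 + p 3 ^ 2) * (q 1 ^ 2 + q 2 ^ 2 + q 3 ^ 2) := by
    nlinarith [sq_nonneg (p 1 * q 2 - p 2 * q 1), sq_nonneg (p 1 * q 3 - p 3 * q 1),
      sq_nonneg (p 2 * q 3 - p 3 * q 2)]
  have e1 : p 1 ^ 2 + p 2 ^ 2 + p 3 ^ 2 = p 0 ^ 2 - 1 := by linarith
  have e2 : q 1 ^ 2 + q 2 ^ 2 + q 3 ^ 2 = q 0 ^ 2 - 1 := by linarith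
  rw [e1, e2] at cs
  have f1 : 0 ≤ p 0 ^ 2 - 1 := by rw [← e1]; positivity
  have f2 : 0 ≤ q 0 ^ 2 - 1 := by rw [← e2]; positivity
  have : (p 0 * q 0) ^ 2 ≤ (p 1 * q 1 + p 2 * q 2 + p 3 * q 3) ^ 2 := by
    apply pow_le_pow_left₀ hpq.le; linarith
  nlinarith

lemma mink_lt {p q : Fin 4 → ℝ} (hp : p ∈ Hyp) (hq : q ∈ Hyp) (hne : p ≠ q) :
    mink p q < -1 := by
  have hn := mink_neg hp hq
  have h1 := flat_inner hp (mink_tang hp q) (mink_tang hp q)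
  rw [mink_tangdir hp, hq.2] at h1
  have h2 : 0 < inner ℝ (flat p (tangdir p q)) (flat p (tangdir p q)) := by
    rw [real_inner_self_pos]
    intro h
    rw [← flat_zero p] at h
    have h3 := flat_inj hp (mink_tang hp q) (by simp [mink]) h
    rw [h3, flat_zero, inner_zero_left] at h1
    have h4 : mink p q = -1 := by nlinarith
    apply hne
    unfold tangdir at h3
    rw [h4] at h3
    have : q - p = 0 := by rw [← h3]; simp [sub_eq_add_neg]
    exact (sub_eq_zero.1 this).symm
  rw [h1] at h2
  nlinarith

lemma tangdir_dep {p q r : Fin 4 → ℝ} {c : ℝ} (h : tangdir p r = c • tangdir p q)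
    {W : Submodule ℝ (Fin 4 → ℝ)} (hpW : p ∈ W) (hq : q ∈ W) : r ∈ W := by
  have : r = c • tangdir p q - mink p r • p := by
    rw [← h]; simp [tangdir]
  rw [this]
  exact W.sub_mem (W.smul_mem _ (W.add_mem hq (W.smul_mem _ hpW))) (W.smul_mem _ hpW)

lemma flat_dep {p q r : Fin 4 → ℝ} (hp : p ∈ Hyp) {c : ℝ}
    (h : flat p (tangdir p r) = c • flat p (tangdir p q))
    {W : Submodule ℝ (Fin 4 → ℝ)} (hpW : p ∈ W) (hq : q ∈ W) : r ∈ W := by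
  refine tangdir_dep (c := c) (flat_inj hp (mink_tang hp r) ?_ ?_) hpW hq
  · have : mink p (c • tangdir p q) = c * mink p (tangdir p q) := by simp [mink]; ring
    rw [this, mink_tang hp, mul_zero]
  · rw [h, flat_smul]

lemma mem_of_angle_pi {p q r : Fin 4 → ℝ} (hp : p ∈ Hyp) (h : intAngle q p r = Real.pi)
    {W : Submodule ℝ (Fin 4 → ℝ)} (hpW : p ∈ W) (hq : q ∈ W) : r ∈ W := by
  rw [intAngle_eq hp, InnerProductGeometry.angle_eq_pi_iff] at h
  obtain ⟨_, c, _, hc⟩ := h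
  exact flat_dep hp hc hpW hq

lemma norm_flat {p q : Fin 4 → ℝ} (hp : p ∈ Hyp) (hq : q ∈ Hyp) :
    ‖flat p (tangdir p q)‖ ^ 2 = mink p q ^ 2 - 1 := by
  rw [← real_inner_self_eq_norm_sq, flat_inner hp (mink_tang hp q) (mink_tang hp q),
    mink_tangdir hp, hq.2]; ring

lemma inner_flat {p : Fin 4 → ℝ} (hp : p ∈ Hyp) (q r : Fin 4 → ℝ) :
    inner ℝ (flat p (tangdir p q)) (flat p (tangdir p r)) = mink q r + mink p q * mink p r := by
  rw [flat_inner hp (mink_tang hp q) (mink_tang hp r), mink_tangdir hp]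

/-- Real-number form of the hyperbolic angle sum inequality. -/
lemma angle_real {a b c x y z A B C : ℝ} (ha : 1 < a) (hb : 1 < b) (hc : 1 < c)
    (hx : 0 < x) (hy : 0 < y) (hz : 0 < z)
    (hxa : x ^ 2 = a ^ 2 - 1) (hyb : y ^ 2 = b ^ 2 - 1) (hzc : z ^ 2 = c ^ 2 - 1)
    (hD : 0 ≤ 1 + 2 * a * b * c - a ^ 2 - b ^ 2 - c ^ 2)
    (hA0 : 0 ≤ A) (hA1 : A ≤ Real.pi) (hB0 : 0 ≤ B) (hB1 : B ≤ Real.pi)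
    (hC0 : 0 ≤ C) (hC1 : C ≤ Real.pi)
    (hA : Real.cos A * (y * z) = b * c - a) (hB : Real.cos B * (x * z) = a * c - b)
    (hC : Real.cos C * (x * y) = a * b - c) :
    A + B + C ≤ Real.pi ∧
      (A + B + C = Real.pi → 1 + 2 * a * b * c - a ^ 2 - b ^ 2 - c ^ 2 = 0) := by
  set D := 1 + 2 * a * b * c - a ^ 2 - b ^ 2 - c ^ 2 with hDdef
  have hsA : Real.sin A * (y * z) = √D := by
    have h0 := Real.sin_nonneg_of_nonneg_of_le_pi hA0 hA1
    rw [eq_comm, Real.sqrt_eq_iff_mul_self_eq hD (by positivity)]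
    have := Real.sin_sq_add_cos_sq A
    have e : (Real.sin A * (y * z)) * (Real.sin A * (y * z)) =
      (1 - Real.cos A ^ 2) * (y * z) ^ 2 := by rw [← this]; ring
    rw [e]
    have : (1 - Real.cos A ^ 2) * (y * z) ^ 2 = y ^ 2 * z ^ 2 - (Real.cos A * (y * z)) ^ 2 := by
      ring
    rw [this, hA, hyb, hzc]; ring
  have hsB : Real.sin B * (x * z) = √D := by
    have h0 := Real.sin_nonneg_of_nonneg_of_le_pi hB0 hB1
    rw [eq_comm, Real.sqrt_eq_iff_mul_self_eq hD (by positivity)]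
    have := Real.sin_sq_add_cos_sq B
    have e : (Real.sin B * (x * z)) * (Real.sin B * (x * z)) =
      (1 - Real.cos B ^ 2) * (x * z) ^ 2 := by rw [← this]; ring
    rw [e]
    have : (1 - Real.cos B ^ 2) * (x * z) ^ 2 = x ^ 2 * z ^ 2 - (Real.cos B * (x * z)) ^ 2 := by
      ring
    rw [this, hB, hxa, hzc]; ring
  have hsq : √D * √D = D := Real.mul_self_sqrt hD
  have key : (Real.cos (A + B) + Real.cos C) * (x * y * z ^ 2) = (c - 1) * D := by
    have : (Real.cos (A + B) + Real.cos C) * (x * y * z ^ 2) =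
      (Real.cos A * (y * z)) * (Real.cos B * (x * z)) -
      (Real.sin A * (y * z)) * (Real.sin B * (x * z)) + (Real.cos C * (x * y)) * z ^ 2 := by
      rw [Real.cos_add]; ring
    rw [this, hA, hB, hC, hsA, hsB, hsq, hzc]; ring
  have hpos : 0 < x * y * z ^ 2 := by positivity
  have hcos : 0 ≤ Real.cos (A + B) + Real.cos C := by
    have : 0 ≤ (c - 1) * D := mul_nonneg (by linarith) hD
    rw [← key] at this
    exact nonneg_of_mul_nonneg_left this hpos
  have hxy : a * b - x * y ≤ c := by
    have h1 : (a * b - c) ^ 2 ≤ (x * y) ^ 2 := by rw [mul_pow, hxa, hyb]; linarith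
    have := abs_le_of_sq_le_sq' h1 (by positivity)
    linarith [this.2]
  have hAB : A + B ≤ Real.pi := by
    have h1 : 0 ≤ (Real.cos A + Real.cos B) * (x * y * z) := by
      have : (Real.cos A + Real.cos B) * (x * y * z) =
        x * (Real.cos A * (y * z)) + y * (Real.cos B * (x * z)) := by ring
      rw [this, hA, hB]
      have h2 : (a * b - x * y) * (x * b + y * a) ≤ c * (x * b + y * a) :=
        mul_le_mul_of_nonneg_right hxy (by positivity)
      have h3 : (a * b - x * y) * (x * b + y * a) = a * x + b * y := by
        have : (a * b - x * y) * (x * b + y * a) =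
          a * x * (b ^ 2 - y ^ 2) + b * y * (a ^ 2 - x ^ 2) := by ring
        rw [this, hxa, hyb]; ring
      linarith
    have h2 : 0 ≤ Real.cos A + Real.cos B := nonneg_of_mul_nonneg_left h1 (by positivity)
    by_contra h
    have := Real.cos_lt_cos_of_nonneg_of_le_pi (x := Real.pi - B) (y := A) (by linarith) hA1
      (by linarith)
    rw [Real.cos_pi_sub] at this
    linarith
  constructor
  · by_contra h
    have := Real.cos_lt_cos_of_nonneg_of_le_pi (x := Real.pi - C) (y := A + B) (by linarith) hAB
      (by linarith)
    rw [Real.cos_pi_sub] at this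
    linarith
  · intro h
    have : A + B = Real.pi - C := by linarith
    rw [this, Real.cos_pi_sub, neg_add_cancel, zero_mul] at key
    rcases mul_eq_zero.1 key.symm with h | h
    · linarith
    · exact h

lemma triangle_sum {p q r : Fin 4 → ℝ} (hp : p ∈ Hyp) (hq : q ∈ Hyp) (hr : r ∈ Hyp)
    (hqr : q ≠ r) :
    intAngle q p r + intAngle p q r + intAngle q r p ≤ Real.pi ∧
    (intAngle q p r + intAngle p q r + intAngle q r p = Real.pi → p ≠ q →
      ∀ W : Submodule ℝ (Fin 4 → ℝ), p ∈ W → q ∈ W → r ∈ W) := by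
  have nz : ∀ {s t : Fin 4 → ℝ}, s ∈ Hyp → t ∈ Hyp → s ≠ t → flat s (tangdir s t) ≠ 0 := by
    intro s t hs ht hst h
    have h1 := norm_flat hs ht
    have h2 := mink_lt hs ht hst
    rw [h, norm_zero] at h1
    nlinarith
  have self0 : ∀ {s t : Fin 4 → ℝ}, s ∈ Hyp → t ∈ Hyp → s ≠ t → intAngle t s t = 0 := by
    intro s t hs ht hst
    rw [intAngle_eq hs]
    exact InnerProductGeometry.angle_self (nz hs ht hst)
  by_cases hpq : p = q
  · subst hpq
    refine ⟨?_, fun _ h => absurd rfl h⟩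
    rw [intAngle_self_left hp, self0 hr hp hqr.symm]; linarith
  by_cases hpr : p = r
  · subst hpr
    refine ⟨?_, fun _ _ W h _ => h⟩
    rw [intAngle_self_right hp, self0 hq hp hqr]; linarith
  have n1 := nz hp hq hpq
  have n2 := nz hp hr hpr
  have n3 := nz hq hr hqr
  have n4 := nz hq hp (Ne.symm hpq)
  have m1 := mink_lt hp hq hpq
  have m2 := mink_lt hp hr hpr
  have m3 := mink_lt hq hr hqr
  have sw : ∀ {s t : Fin 4 → ℝ}, s ∈ Hyp → t ∈ Hyp →
      ‖flat s (tangdir s t)‖ = ‖flat t (tangdir t s)‖ := by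
    intro s t hs ht
    have h1 := norm_flat hs ht
    have h2 := norm_flat ht hs
    rw [mink_comm' t s, ← h1] at h2
    exact ((sq_eq_sq₀ (norm_nonneg _) (norm_nonneg _)).1 h2).symm
  have cs := abs_real_inner_le_norm (flat p (tangdir p q)) (flat p (tangdir p r))
  have csq := sq_le_sq' (abs_le.1 cs).1 (abs_le.1 cs).2
  rw [mul_pow, norm_flat hp hq, norm_flat hp hr, inner_flat hp] at csq
  have main := angle_real (a := -mink q r) (b := -mink p r) (c := -mink p q)
    (x := ‖flat q (tangdir q r)‖) (y := ‖flat p (tangdir p r)‖) (z := ‖flat p (tangdir p q)‖)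
    (A := intAngle q p r) (B := intAngle p q r) (C := intAngle q r p)
    (by linarith) (by linarith) (by linarith)
    (norm_pos_iff.2 n3) (norm_pos_iff.2 n2) (norm_pos_iff.2 n1)
    (by rw [norm_flat hq hr]; ring) (by rw [norm_flat hp hr]; ring)
    (by rw [norm_flat hp hq]; ring) (by nlinarith)
    (Real.arccos_nonneg _) (Real.arccos_le_pi _) (Real.arccos_nonneg _) (Real.arccos_le_pi _)
    (Real.arccos_nonneg _) (Real.arccos_le_pi _)
    (by rw [intAngle_eq hp, mul_comm ‖flat p (tangdir p r)‖,
          InnerProductGeometry.cos_angle_mul_norm_mul_norm, inner_flat hp]; ring)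
    (by rw [intAngle_eq hq, sw hp hq, mul_comm ‖flat q (tangdir q r)‖,
          InnerProductGeometry.cos_angle_mul_norm_mul_norm, inner_flat hq, mink_comm' q p]; ring)
    (by rw [intAngle_eq hr, sw hp hr, sw hq hr,
          InnerProductGeometry.cos_angle_mul_norm_mul_norm, inner_flat hr, mink_comm' r p,
          mink_comm' r q, mink_comm' q p]; ring)
  refine ⟨main.1, fun h _ W hpW hqW => ?_⟩
  have hD := main.2 h
  have h1 : |inner ℝ (flat p (tangdir p q)) (flat p (tangdir p r)) /
      (‖flat p (tangdir p q)‖ * ‖flat p (tangdir p r)‖)| = 1 := by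
    rw [← sq_eq_sq₀ (abs_nonneg _) zero_le_one, sq_abs, div_pow, mul_pow, norm_flat hp hq,
      norm_flat hp hr, inner_flat hp, div_eq_iff]
    · linarith
    · apply ne_of_gt; apply mul_pos <;> nlinarith
  rw [abs_real_inner_div_norm_mul_norm_eq_one_iff] at h1
  obtain ⟨_, c, _, hc⟩ := h1
  exact flat_dep hp hc hpW hqW

lemma path_angle {o : Fin 4 → ℝ} (ho : o ∈ Hyp) (x : ℕ → Fin 4 → ℝ) (m : ℕ) :
    intAngle (x 0) o (x (m + 1)) ≤ ∑ i ∈ Finset.range (m + 1), intAngle (x i) o (x (i + 1)) := by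
  induction m with
  | zero => simp
  | succ m ih =>
    rw [Finset.sum_range_succ]
    exact (intAngle_triangle ho _ (x (m + 1)) _).trans (by linarith)

/-- Hyperbolic Fenchel theorem: the total turning of a closed polygonal curve
in H³ not contained in a geodesic is strictly greater than 2π. -/
theorem hyperbolic_fenchel (k : ℕ) [NeZero k] (hk : 3 ≤ k)
    (p : ZMod k → (Fin 4 → ℝ)) (hp : ∀ j, p j ∈ Hyp)
    (hne : ∀ j, p j ≠ p (j + 1))
    (hline : ¬ ∃ W : Submodule ℝ (Fin 4 → ℝ),
        Module.finrank ℝ W = 2 ∧ ∀ j, p j ∈ W) :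
    2 * Real.pi < ∑ j : ZMod k, (Real.pi - intAngle (p (j - 1)) (p j) (p (j + 1))) := by
  obtain ⟨m, rfl⟩ : ∃ m, k = m + 3 := ⟨k - 3, by omega⟩
  set θ : ZMod (m + 3) → ℝ := fun j => intAngle (p (j - 1)) (p j) (p (j + 1)) with hθ
  set A : ZMod (m + 3) → ℝ := fun j => intAngle (p j) (p 0) (p (j + 1)) with hA
  set B : ZMod (m + 3) → ℝ := fun j => intAngle (p (j - 1)) (p j) (p 0) with hB
  set C : ZMod (m + 3) → ℝ := fun j => intAngle (p 0) (p j) (p (j + 1)) with hC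
  have hE : ∀ j, A j + C j + B (j + 1) ≤ Real.pi := by
    intro j
    have := (triangle_sum (hp 0) (hp j) (hp (j + 1)) (hne j)).1
    simpa [hA, hB, hC] using this
  have hF : ∀ j, θ j ≤ B j + C j := fun j => intAngle_triangle (hp j) _ _ _
  have hB0 : B 0 = Real.pi / 2 := intAngle_self_right (hp 0) _
  have hC0 : C 0 = Real.pi / 2 := intAngle_self_left (hp 0) _
  have hθ0 : θ 0 + Real.pi ≤ ∑ j, A j := by
    have h1 : ∑ j, A j = ∑ i ∈ Finset.range (m + 3), A (i : ZMod (m + 3)) := by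
      rw [Finset.sum_range]
      apply Finset.sum_congr rfl
      intro i _
      congr 1
      exact (Fin.cast_val_eq_self i).symm
    have hlast : ((m + 2 : ℕ) : ZMod (m + 3)) + 1 = 0 := by
      have := ZMod.natCast_self (m + 3)
      rw [← this]; push_cast; ring
    have h2 : A ((m + 2 : ℕ) : ZMod (m + 3)) = Real.pi / 2 := by
      simp only [hA]
      rw [hlast]
      exact intAngle_self_right (hp 0) _
    have h3 : A ((0 : ℕ) : ZMod (m + 3)) = Real.pi / 2 := by
      simp only [hA, Nat.cast_zero]
      exact intAngle_self_left (hp 0) _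
    rw [h1, Finset.sum_range_succ, Finset.sum_range_succ', h2, h3]
    have h4 := path_angle (hp 0) (fun i : ℕ => p ((i + 1 : ℕ) : ZMod (m + 3))) m
    have h5 : ((m + 1 + 1 : ℕ) : ZMod (m + 3)) = 0 - 1 := by
      rw [eq_sub_iff_add_eq]; exact hlast
    have h6 : intAngle (p ((0 + 1 : ℕ) : ZMod (m + 3))) (p 0)
        (p ((m + 1 + 1 : ℕ) : ZMod (m + 3))) = θ 0 := by
      rw [h5, intAngle_comm (hp 0)]
      simp [hθ]
    have h7 : ∑ i ∈ Finset.range (m + 1), intAngle (p ((i + 1 : ℕ) : ZMod (m + 3))) (p 0)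
        (p ((i + 1 + 1 : ℕ) : ZMod (m + 3))) =
        ∑ i ∈ Finset.range (m + 1), A ((i + 1 : ℕ) : ZMod (m + 3)) := by
      apply Finset.sum_congr rfl
      intro i _
      simp [hA]
    beta_reduce at h4
    rw [h7, h6] at h4
    linarith
  have hshift : ∑ j, B (j + 1) = ∑ j, B j := Equiv.sum_comp (Equiv.addRight (1 : ZMod (m + 3))) B
  have hsplit : ∑ j, (B j + C j - θ j) =
      (B 0 + C 0 - θ 0) + ∑ j ∈ Finset.univ.erase 0, (B j + C j - θ j) :=
    (Finset.add_sum_erase _ _ (Finset.mem_univ 0)).symm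
  have hEs : ∑ j, (Real.pi - (A j + C j + B (j + 1))) =
      ∑ j : ZMod (m + 3), Real.pi - ∑ j, A j - ∑ j, C j - ∑ j, B j := by
    rw [← hshift]; simp only [Finset.sum_sub_distrib, Finset.sum_add_distrib]; ring
  have hFs : ∑ j, (B j + C j - θ j) = ∑ j, B j + ∑ j, C j - ∑ j, θ j := by
    simp only [Finset.sum_sub_distrib, Finset.sum_add_distrib]
  have hE0 : 0 ≤ ∑ j, (Real.pi - (A j + C j + B (j + 1))) :=
    Finset.sum_nonneg fun j _ => by linarith [hE j]
  have hF0 : 0 ≤ ∑ j ∈ Finset.univ.erase 0, (B j + C j - θ j) :=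
    Finset.sum_nonneg fun j _ => by linarith [hF j]
  rw [Finset.sum_sub_distrib]
  by_contra hcon
  push Not at hcon
  have hE1 : ∑ j, (Real.pi - (A j + C j + B (j + 1))) = 0 := by linarith
  have hF1 : ∑ j ∈ Finset.univ.erase 0, (B j + C j - θ j) = 0 := by linarith
  rw [Finset.sum_eq_zero_iff_of_nonneg (fun j _ => by linarith [hE j])] at hE1
  rw [Finset.sum_eq_zero_iff_of_nonneg (fun j _ => by linarith [hF j])] at hF1
  apply hline
  have hne0 : p 0 ≠ p 1 := by simpa using hne 0
  have hm := mink_lt (hp 0) (hp 1) hne0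
  refine ⟨Submodule.span ℝ {p 0, p 1}, ?_, ?_⟩
  · have hli : LinearIndependent ℝ ![p 0, p 1] := by
      rw [LinearIndependent.pair_iff]
      intro s t hst
      have e1 : s * mink (p 0) (p 0) + t * mink (p 0) (p 1) = 0 := by
        have : mink (p 0) (s • p 0 + t • p 1) = 0 := by rw [hst]; simp [mink]
        rw [← this]; simp [mink]; ring
      have e2 : s * mink (p 0) (p 1) + t * mink (p 1) (p 1) = 0 := by
        have : mink (p 1) (s • p 0 + t • p 1) = 0 := by rw [hst]; simp [mink]
        rw [← this]; simp [mink]; ring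
      rw [(hp 0).2] at e1
      rw [(hp 1).2] at e2
      have e3 : t * (mink (p 0) (p 1) ^ 2 - 1) = 0 := by
        linear_combination mink (p 0) (p 1) * e1 + e2
      have ht : t = 0 := by
        rcases mul_eq_zero.1 e3 with h | h
        · exact h
        · nlinarith
      subst ht
      exact ⟨by linarith, rfl⟩
    have := finrank_span_eq_card hli
    rw [Matrix.range_cons, Matrix.range_cons, Matrix.range_empty, Set.union_empty] at this
    rw [Set.insert_eq, this, Fintype.card_fin]
  · set W := Submodule.span ℝ {p 0, p 1} with hW
    have w0 : p 0 ∈ W := Submodule.subset_span (by simp)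
    have w1 : p 1 ∈ W := Submodule.subset_span (by simp)
    have ind : ∀ n : ℕ, p (n : ZMod (m + 3)) ∈ W ∧ p ((n : ZMod (m + 3)) + 1) ∈ W := by
      intro n
      induction n with
      | zero => simpa using ⟨w0, w1⟩
      | succ n ih =>
        push_cast
        refine ⟨ih.2, ?_⟩
        set j : ZMod (m + 3) := (n : ZMod (m + 3)) + 1 with hj
        have hn : (n : ZMod (m + 3)) = j - 1 := by rw [hj]; ring
        rw [hn] at ih
        by_cases hj0 : j = 0
        · rw [hj0]; simpa using w1
        by_cases hpj : p j = p 0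
        · have h1 := hF1 j (by simp [hj0])
          have h2 : B j = Real.pi / 2 := by
            simp only [hB]; rw [← hpj]; exact intAngle_self_right (hp j) _
          have h3 : C j = Real.pi / 2 := by
            simp only [hC]; rw [← hpj]; exact intAngle_self_left (hp j) _
          have h4 : θ j = Real.pi := by linarith
          exact mem_of_angle_pi (hp j) h4 ih.2 ih.1
        · have h1 := hE1 j (Finset.mem_univ _)
          have h2 : A j + C j + B (j + 1) = Real.pi := by linarith
          refine (triangle_sum (hp 0) (hp j) (hp (j + 1)) (hne j)).2 ?_ (Ne.symm hpj) W w0 ih.2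
          simpa [hA, hB, hC] using h2
    intro j
    have := (ind j.val).1
    rwa [ZMod.natCast_zmod_val] at this
end
end
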